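/- Let W be a discrete memoryless channel with finite input alphabet X and finite output alphabet Y such that every output is accessible, and let v > 0. Then there exist μ > 0, η > 0 and a finite constant β > 0 such that for every P ∈ Π_μ with V(P,W) ≥ v and every Q ∈ Γ_μ^η: (1) V(W‖Q|P) ≥ v/2 > 0; (2) |√(V(P,W)) − √(V(P*,W))| ≤ β·‖P − P*‖₂, where P* is the Euclidean projection of P onto Π; and (3) |√(V(W‖Q|P)) − √(V(P,W))| ≤ β·‖Q − PW‖₂. -/

import Mathlib

open Finset MeasureTheory

/-- `P` is a probability distribution on the finite set `Z`. -/
def IsDist {Z : Type*} [Fintype Z] (P : Z → ℝ) : Prop :=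
  (∀ z, 0 ≤ P z) ∧ ∑ z, P z = 1

/-- `W` is a (discrete memoryless) channel from `X` to `Y`: a stochastic matrix. -/
def IsChannel {X Y : Type*} [Fintype X] [Fintype Y] (W : X → Y → ℝ) : Prop :=
  ∀ x, IsDist (W x)

/-- Relative entropy `D(P‖Q) = Σ_z P(z) log (P(z)/Q(z))`. -/
noncomputable def relEnt {Z : Type*} [Fintype Z] (P Q : Z → ℝ) : ℝ :=
  ∑ z, P z * Real.log (P z / Q z)

/-- Divergence variance `V(P‖Q)`. -/
noncomputable def divVar {Z : Type*} [Fintype Z] (P Q : Z → ℝ) : ℝ :=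
  ∑ z, P z * (Real.log (P z / Q z) - relEnt P Q) ^ 2

/-- Output distribution `PW`. -/
noncomputable def outDist {X Y : Type*} [Fintype X] (P : X → ℝ) (W : X → Y → ℝ) (y : Y) : ℝ :=
  ∑ x, P x * W x y

/-- Mutual information `I(P,W) = Σ_x P(x) D(W(·|x)‖PW)`. -/
noncomputable def mutInfo {X Y : Type*} [Fintype X] [Fintype Y] (P : X → ℝ) (W : X → Y → ℝ) : ℝ :=
  ∑ x, P x * relEnt (W x) (outDist P W)

/-- Channel capacity `C = max_P I(P,W)`. -/
noncomputable def capacity {X Y : Type*} [Fintype X] [Fintype Y] (W : X → Y → ℝ) : ℝ :=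
  sSup {c : ℝ | ∃ P : X → ℝ, IsDist P ∧ c = mutInfo P W}

/-- `P` is a capacity-achieving input distribution (member of `Π`). -/
def isCAID {X Y : Type*} [Fintype X] [Fintype Y] (W : X → Y → ℝ) (P : X → ℝ) : Prop :=
  IsDist P ∧ mutInfo P W = capacity W

/-- Conditional information variance `V(P,W) = Σ_x P(x) V(W(·|x)‖PW)`. -/
noncomputable def infoVar {X Y : Type*} [Fintype X] [Fintype Y] (P : X → ℝ) (W : X → Y → ℝ) : ℝ :=
  ∑ x, P x * divVar (W x) (outDist P W)

/-- `V_min = min_{P ∈ Π} V(P,W)`. -/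
noncomputable def Vmin {X Y : Type*} [Fintype X] [Fintype Y] (W : X → Y → ℝ) : ℝ :=
  sInf {v : ℝ | ∃ P : X → ℝ, isCAID W P ∧ v = infoVar P W}

/-- `V_max = max_{P ∈ Π} V(P,W)`. -/
noncomputable def Vmax {X Y : Type*} [Fintype X] [Fintype Y] (W : X → Y → ℝ) : ℝ :=
  sSup {v : ℝ | ∃ P : X → ℝ, isCAID W P ∧ v = infoVar P W}

/-- The `ε`-channel dispersion `V_ε`. -/
noncomputable def Veps {X Y : Type*} [Fintype X] [Fintype Y] (W : X → Y → ℝ) (ε : ℝ) : ℝ :=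
  if ε < 1/2 then Vmin W else Vmax W

/-- Euclidean norm of the difference of two functions on a finite set. -/
noncomputable def dist2 {Z : Type*} [Fintype Z] (P Q : Z → ℝ) : ℝ :=
  Real.sqrt (∑ z, (P z - Q z) ^ 2)

/-- Conditional divergence variance `V(W‖Q|P) = Σ_x P(x) V(W(·|x)‖Q)`. -/
noncomputable def condDivVar {X Y : Type*} [Fintype X] [Fintype Y]
    (W : X → Y → ℝ) (Q : Y → ℝ) (P : X → ℝ) : ℝ :=
  ∑ x, P x * divVar (W x) Q

open Real in
/-- `I(P,W)` is the output entropy minus the conditional entropy. -/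
lemma mutInfo_eq_entropy_sub {X Y : Type*} [Fintype X] [Fintype Y] {W : X → Y → ℝ}
    (hW : IsChannel W) {P : X → ℝ} (hP : ∀ x, 0 ≤ P x) :
    mutInfo P W = ∑ y, negMulLog (outDist P W y) - ∑ x, P x * ∑ y, negMulLog (W x y) := by
  have key : ∀ x y, P x * (W x y * log (W x y / outDist P W y)) =
      -(P x * W x y * log (outDist P W y)) - P x * negMulLog (W x y) := by
    intro x y
    rcases (hP x).eq_or_lt with h | h
    · simp [← h]
    rcases ((hW x).1 y).eq_or_lt with h' | h'
    · simp [← h']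
    have hq : 0 < outDist P W y :=
      Finset.sum_pos' (fun i _ => mul_nonneg (hP i) ((hW i).1 y))
        ⟨x, Finset.mem_univ _, mul_pos h h'⟩
    rw [log_div h'.ne' hq.ne', negMulLog]
    ring
  have hq : ∀ y, negMulLog (outDist P W y) = ∑ x, -(P x * W x y * log (outDist P W y)) := by
    intro y
    rw [Finset.sum_neg_distrib, ← Finset.sum_mul, negMulLog, neg_mul]
    rfl
  simp only [mutInfo, relEnt, Finset.mul_sum, key, Finset.sum_sub_distrib, hq]
  rw [Finset.sum_comm]

lemma IsDist.le_one {Z : Type*} [Fintype Z] {P : Z → ℝ} (hP : IsDist P) (z : Z) : P z ≤ 1 :=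
  hP.2 ▸ Finset.single_le_sum (fun i _ => hP.1 i) (Finset.mem_univ z)

lemma IsDist.outDist {X Y : Type*} [Fintype X] [Fintype Y] {W : X → Y → ℝ}
    (hW : IsChannel W) {P : X → ℝ} (hP : IsDist P) : IsDist (outDist P W) := by
  refine ⟨fun y => Finset.sum_nonneg fun x _ => mul_nonneg (hP.1 x) ((hW x).1 y), ?_⟩
  simp only [_root_.outDist]
  rw [Finset.sum_comm]
  simp [← Finset.mul_sum, (hW _).2, hP.2]

lemma Real.negMulLog_le_one {x : ℝ} (hx : 0 ≤ x) : Real.negMulLog x ≤ 1 := by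
  rcases hx.eq_or_lt with rfl | h
  · simp
  have h1 := mul_le_mul_of_nonneg_left (Real.one_sub_inv_le_log_of_pos h) hx
  rw [mul_sub, mul_inv_cancel₀ h.ne'] at h1
  rw [Real.negMulLog]
  linarith

lemma IsDist.entropy_nonneg {Z : Type*} [Fintype Z] {P : Z → ℝ} (hP : IsDist P) :
    0 ≤ ∑ z, Real.negMulLog (P z) :=
  Finset.sum_nonneg fun z _ => Real.negMulLog_nonneg (hP.1 z) (hP.le_one z)

lemma mutInfo_le_capacity {X Y : Type*} [Fintype X] [Fintype Y] {W : X → Y → ℝ}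
    (hW : IsChannel W) {P : X → ℝ} (hP : IsDist P) : mutInfo P W ≤ capacity W := by
  refine le_csSup ⟨∑ _y : Y, (1 : ℝ), ?_⟩ ⟨P, hP, rfl⟩
  rintro _ ⟨P', hP', rfl⟩
  rw [mutInfo_eq_entropy_sub hW hP'.1]
  have h1 : ∑ y, Real.negMulLog (outDist P' W y) ≤ ∑ _y : Y, (1 : ℝ) :=
    Finset.sum_le_sum fun y _ => Real.negMulLog_le_one ((hP'.outDist hW).1 y)
  have h2 : 0 ≤ ∑ x, P' x * ∑ y, Real.negMulLog (W x y) :=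
    Finset.sum_nonneg fun x _ => mul_nonneg (hP'.1 x) (hW x).entropy_nonneg
  linarith

lemma IsDist.mix {Z : Type*} [Fintype Z] {P Q : Z → ℝ} (hP : IsDist P) (hQ : IsDist Q)
    {t : ℝ} (h0 : 0 ≤ t) (h1 : t ≤ 1) : IsDist fun z => (1 - t) * P z + t * Q z := by
  refine ⟨fun z => add_nonneg (mul_nonneg (by linarith) (hP.1 z)) (mul_nonneg h0 (hQ.1 z)), ?_⟩
  rw [Finset.sum_add_distrib, ← Finset.mul_sum, ← Finset.mul_sum, hP.2, hQ.2]
  ring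

lemma outDist_mix {X Y : Type*} [Fintype X] (W : X → Y → ℝ) (P Q : X → ℝ) (t : ℝ) (y : Y) :
    outDist (fun x => (1 - t) * P x + t * Q x) W y =
      (1 - t) * outDist P W y + t * outDist Q W y := by
  simp only [outDist, Finset.mul_sum, ← Finset.sum_add_distrib]
  exact Finset.sum_congr rfl fun x _ => by ring

/-- The capacity-achieving output distribution is unique. -/
lemma isCAID.outDist_eq {X Y : Type*} [Fintype X] [Fintype Y] {W : X → Y → ℝ}
    (hW : IsChannel W) {P P' : X → ℝ} (hP : isCAID W P) (hP' : isCAID W P') :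
    outDist P W = outDist P' W := by
  by_contra hne
  obtain ⟨y₀, hy₀⟩ := Function.ne_iff.mp hne
  have hM := hP.1.mix hP'.1 (t := 1 / 2) (by norm_num) (by norm_num)
  have hC := mutInfo_le_capacity hW hM
  have e := hP.2
  have e' := hP'.2
  rw [mutInfo_eq_entropy_sub hW hM.1] at hC
  rw [mutInfo_eq_entropy_sub hW hP.1.1] at e
  rw [mutInfo_eq_entropy_sub hW hP'.1.1] at e'
  simp only [outDist_mix, add_mul, Finset.sum_add_distrib, mul_assoc, ← Finset.mul_sum] at hC
  have hlt : ∑ y, ((1 - 1 / 2) * Real.negMulLog (outDist P W y) +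
      1 / 2 * Real.negMulLog (outDist P' W y)) <
      ∑ y, Real.negMulLog ((1 - 1 / 2) * outDist P W y + 1 / 2 * outDist P' W y) := by
    refine Finset.sum_lt_sum (fun y _ => ?_) ⟨y₀, Finset.mem_univ _, ?_⟩
    · exact Real.concaveOn_negMulLog.2 ((hP.1.outDist hW).1 y) ((hP'.1.outDist hW).1 y)
        (by norm_num) (by norm_num) (by norm_num)
    · exact Real.strictConcaveOn_negMulLog.2 ((hP.1.outDist hW).1 y₀) ((hP'.1.outDist hW).1 y₀)
        hy₀ (by norm_num) (by norm_num) (by norm_num)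
  simp only [Finset.sum_add_distrib, ← Finset.mul_sum] at hlt
  linarith

/-- The Gibbs inequality, allowing distributions with zeros. -/
lemma IsDist.entropy_le_cross {Z : Type*} [Fintype Z] {P Q : Z → ℝ} (hP : IsDist P)
    (hQ : IsDist Q) (hPQ : ∀ z, Q z = 0 → P z = 0) :
    ∑ z, Real.negMulLog (P z) ≤ ∑ z, -(P z * Real.log (Q z)) := by
  have h : ∀ z, Real.negMulLog (P z) ≤ -(P z * Real.log (Q z)) + (Q z - P z) := by
    intro z
    rcases (hP.1 z).eq_or_lt with h | h
    · simpa [← h] using hQ.1 z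
    have hq : 0 < Q z := (hQ.1 z).lt_of_ne' fun h0 => h.ne' (hPQ z h0)
    have h1 := mul_le_mul_of_nonneg_left (Real.log_le_sub_one_of_pos (div_pos hq h)) h.le
    rw [Real.log_div hq.ne' h.ne', mul_sub, mul_sub, mul_div_cancel₀ _ h.ne'] at h1
    rw [Real.negMulLog]
    linarith
  have := Finset.sum_le_sum fun z (_ : z ∈ Finset.univ) => h z
  rw [Finset.sum_add_distrib, Finset.sum_sub_distrib, hP.2, hQ.2] at this
  linarith

/-- Every accessible output has positive probability under a capacity-achieving input. -/
lemma isCAID.outDist_pos {X Y : Type*} [Fintype X] [Fintype Y] {W : X → Y → ℝ}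
    (hW : IsChannel W) {P : X → ℝ} (hP : isCAID W P) {x₀ : X} {y₀ : Y} (hw : 0 < W x₀ y₀) :
    0 < outDist P W y₀ := by
  classical
  have hq := hP.1.outDist hW
  refine (hq.1 y₀).lt_of_ne' fun hzero => ?_
  obtain ⟨e₀, he, he_out, he_sum⟩ : ∃ e₀ : X → ℝ, IsDist e₀ ∧ (∀ y, outDist e₀ W y = W x₀ y) ∧
      ∀ f : X → ℝ, ∑ x, e₀ x * f x = f x₀ :=
    ⟨fun x => if x = x₀ then 1 else 0, ⟨fun x => by positivity, by simp⟩,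
      fun y => by simp [outDist], fun f => by simp⟩
  obtain ⟨K, hK⟩ : ∃ K, K = capacity W + ∑ y, Real.negMulLog (W x₀ y) := ⟨_, rfl⟩
  have hcap : 0 ≤ capacity W := by
    refine le_trans ?_ (mutInfo_le_capacity hW he)
    rw [mutInfo_eq_entropy_sub hW he.1]
    simp [he_out, he_sum]
  have hK0 : 0 ≤ K := hK ▸ add_nonneg hcap (hW x₀).entropy_nonneg
  obtain ⟨t, ht⟩ : ∃ t, t = Real.exp (-(K / W x₀ y₀) - 1) := ⟨_, rfl⟩
  have ht0 : 0 < t := ht ▸ Real.exp_pos _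
  have ht1 : t < 1 := by
    rw [ht, Real.exp_lt_one_iff]
    have := div_nonneg hK0 hw.le
    linarith
  have hM := hP.1.mix he ht0.le ht1.le
  have hqM := hM.outDist hW
  have hC := mutInfo_le_capacity hW hM
  have e := hP.2
  rw [mutInfo_eq_entropy_sub hW hM.1] at hC
  rw [mutInfo_eq_entropy_sub hW hP.1.1] at e
  have hcond : ∑ x, ((1 - t) * P x + t * e₀ x) * ∑ y, Real.negMulLog (W x y) =
      (1 - t) * ∑ x, P x * ∑ y, Real.negMulLog (W x y) + t * ∑ y, Real.negMulLog (W x₀ y) := by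
    simp only [add_mul, Finset.sum_add_distrib, mul_assoc, ← Finset.mul_sum, he_sum]
  rw [hcond] at hC
  generalize hr : outDist (fun x => (1 - t) * P x + t * e₀ x) W = r at *
  have hrq : ∀ y, r y = (1 - t) * outDist P W y + t * W x₀ y := by
    intro y
    rw [← hr, outDist_mix, he_out]
  have hgibbs := hq.entropy_le_cross hqM fun y hy => by
    have h1 := mul_nonneg (sub_pos.2 ht1).le (hq.1 y)
    have h2 := mul_nonneg ht0.le ((hW x₀).1 y)
    have h3 : (1 - t) * outDist P W y = 0 := by linarith [hrq y]
    exact (mul_eq_zero.1 h3).resolve_left (sub_pos.2 ht1).ne'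
  have hsplit : ∑ y, Real.negMulLog (r y) =
      (1 - t) * ∑ y, -(outDist P W y * Real.log (r y)) + t * ∑ y, -(W x₀ y * Real.log (r y)) := by
    simp only [Finset.mul_sum, ← Finset.sum_add_distrib]
    refine Finset.sum_congr rfl fun y _ => ?_
    rw [Real.negMulLog]
    linear_combination -Real.log (r y) * hrq y
  have hsingle : -(W x₀ y₀ * Real.log (r y₀)) ≤ ∑ y, -(W x₀ y * Real.log (r y)) :=
    Finset.single_le_sum (f := fun y => -(W x₀ y * Real.log (r y)))
      (fun y _ => neg_nonneg.2 (mul_nonpos_of_nonneg_of_nonpos ((hW x₀).1 y)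
        (Real.log_nonpos (hqM.1 y) (hqM.le_one y)))) (Finset.mem_univ y₀)
  have hg := mul_le_mul_of_nonneg_left hgibbs (sub_pos.2 ht1).le
  have hbound : t * ∑ y, -(W x₀ y * Real.log (r y)) ≤ t * K := by
    rw [hK]
    have := congrArg (fun a => (1 - t) * a) e
    linarith
  have hle := hsingle.trans (le_of_mul_le_mul_left hbound ht0)
  have hlog : Real.log (r y₀) ≤ -(K / W x₀ y₀) - 1 := by
    rw [hrq, hzero, mul_zero, zero_add, Real.log_mul ht0.ne' hw.ne', ht, Real.log_exp]
    linarith [Real.log_nonpos hw.le ((hW x₀).le_one y₀)]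
  have h4 := mul_le_mul_of_nonneg_left hlog hw.le
  rw [mul_sub, mul_neg, mul_div_cancel₀ _ hw.ne'] at h4
  linarith

/-- `V(W‖Q|P)` is Lipschitz in `(P, Q)` as long as `Q` stays away from the boundary. -/
lemma exists_lipschitzOnWith_condDivVar {X Y : Type*} [Fintype X] [Fintype Y] (W : X → Y → ℝ)
    {δ : ℝ} (hδ : 0 < δ) :
    ∃ K, LipschitzOnWith K (fun p : (X → ℝ) × (Y → ℝ) => condDivVar W p.2 p.1)
      (Set.Icc 0 1 ×ˢ Set.Icc (fun _ : Y => δ) 1) := by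
  have hlog : ∀ x y, ∀ Q : Y → ℝ, Q ∈ Set.Icc (fun _ : Y => δ) 1 →
      W x y * Real.log (W x y / Q y) = W x y * (Real.log (W x y) - Real.log (Q y)) := by
    intro x y Q hQ
    by_cases h : W x y = 0
    · simp [h]
    rw [Real.log_div h (hδ.trans_le (hQ.1 y)).ne']
  have hC : ContDiffOn ℝ 1 (fun p : (X → ℝ) × (Y → ℝ) => ∑ x, p.1 x * ∑ y, W x y *
      (Real.log (W x y) - Real.log (p.2 y) -
        ∑ z, W x z * (Real.log (W x z) - Real.log (p.2 z))) ^ 2)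
      (Set.Icc 0 1 ×ˢ Set.Icc (fun _ : Y => δ) 1) := by
    have hl : ∀ y, ContDiffOn ℝ 1 (fun p : (X → ℝ) × (Y → ℝ) => Real.log (p.2 y))
        (Set.Icc 0 1 ×ˢ Set.Icc (fun _ : Y => δ) 1) := fun y =>
      ContDiffOn.log (by fun_prop) fun p hp => (hδ.trans_le (hp.2.1 y)).ne'
    fun_prop
  refine ContDiffOn.exists_lipschitzOnWith (n := 1) (hC.congr ?_) one_ne_zero
    ((convex_Icc _ _).prod (convex_Icc _ _)) (isCompact_Icc.prod isCompact_Icc)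
  rintro ⟨P, Q⟩ ⟨-, hQ⟩
  simp only [condDivVar, divVar, relEnt]
  refine Finset.sum_congr rfl fun x _ => congrArg _ (Finset.sum_congr rfl fun y _ => ?_)
  by_cases h : W x y = 0
  · simp [h]
  rw [Real.log_div h (hδ.trans_le (hQ.1 y)).ne', Finset.sum_congr rfl fun z _ => hlog x z Q hQ]

lemma abs_sqrt_sub_sqrt_le {a b v : ℝ} (hv : 0 < v) (hb : v ≤ b) (ha : 0 ≤ a) :
    |Real.sqrt a - Real.sqrt b| ≤ |a - b| / Real.sqrt v := by
  have h1 : 0 < Real.sqrt v := Real.sqrt_pos.2 hv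
  have h2 : Real.sqrt v ≤ Real.sqrt a + Real.sqrt b :=
    (Real.sqrt_le_sqrt hb).trans (le_add_of_nonneg_left (Real.sqrt_nonneg a))
  rw [le_div_iff₀ h1]
  have h3 : a - b = (Real.sqrt a - Real.sqrt b) * (Real.sqrt a + Real.sqrt b) := by
    linear_combination -Real.sq_sqrt ha + Real.sq_sqrt (hv.le.trans hb)
  rw [h3, abs_mul]
  exact mul_le_mul_of_nonneg_left (h2.trans (le_abs_self _)) (abs_nonneg _)

lemma condDivVar_nonneg {X Y : Type*} [Fintype X] [Fintype Y] {W : X → Y → ℝ}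
    (hW : IsChannel W) (Q : Y → ℝ) {P : X → ℝ} (hP : IsDist P) : 0 ≤ condDivVar W Q P :=
  Finset.sum_nonneg fun x _ => mul_nonneg (hP.1 x)
    (Finset.sum_nonneg fun y _ => mul_nonneg ((hW x).1 y) (sq_nonneg _))

lemma dist_le_dist2 {Z : Type*} [Fintype Z] (P Q : Z → ℝ) : dist P Q ≤ dist2 P Q :=
  (dist_pi_le_iff (Real.sqrt_nonneg _)).2 fun z => by
    rw [Real.dist_eq, ← Real.sqrt_sq_eq_abs]
    exact Real.sqrt_le_sqrt (Finset.single_le_sum (f := fun z => (P z - Q z) ^ 2)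
      (fun i _ => sq_nonneg _) (Finset.mem_univ z))

lemma dist_outDist_le {X Y : Type*} [Fintype X] [Fintype Y] {W : X → Y → ℝ}
    (hW : IsChannel W) (P R : X → ℝ) :
    dist (outDist P W) (outDist R W) ≤ Fintype.card X * dist P R := by
  refine (dist_pi_le_iff (by positivity)).2 fun y => ?_
  rw [Real.dist_eq, outDist, outDist, ← Finset.sum_sub_distrib]
  refine (Finset.abs_sum_le_sum_abs _ _).trans ?_
  rw [← nsmul_eq_mul]
  refine Finset.sum_le_card_nsmul _ _ _ fun x _ => ?_
  rw [← sub_mul, abs_mul, abs_of_nonneg ((hW x).1 y), ← Real.dist_eq]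
  exact (mul_le_of_le_one_right dist_nonneg ((hW x).le_one y)).trans (dist_le_pi_dist P R x)

/-- For a DMC `W` with all outputs accessible and `v > 0`, there are
`μ, η > 0` and a finite constant `β > 0` such that for every `P ∈ Π_μ` with
`V(P,W) ≥ v` and every `Q ∈ Γ_μ^η`: (1) `V(W‖Q|P) ≥ v/2 > 0`;
(2) `|√V(P,W) - √V(P*,W)| ≤ β ‖P - P*‖₂` for the Euclidean projection `P*` of `P`
onto `Π`; (3) `|√V(W‖Q|P) - √V(P,W)| ≤ β ‖Q - PW‖₂`. -/
theorem variance_continuity_around_CAID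
    {X Y : Type*} [Fintype X] [Fintype Y] [Nonempty X] [Nonempty Y]
    (W : X → Y → ℝ) (hW : IsChannel W) (hacc : ∀ y, ∃ x, 0 < W x y)
    (v : ℝ) (hv : 0 < v) :
    ∃ μ > (0 : ℝ), ∃ η > (0 : ℝ), ∃ β > (0 : ℝ),
      ∀ P : X → ℝ, IsDist P → (∃ P₀ : X → ℝ, isCAID W P₀ ∧ dist2 P P₀ ≤ μ) →
      v ≤ infoVar P W →
      ∀ Q : Y → ℝ, IsDist Q →
        (∃ P₁ : X → ℝ, IsDist P₁ ∧ (∃ P₂ : X → ℝ, isCAID W P₂ ∧ dist2 P₁ P₂ ≤ μ) ∧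
          dist2 (outDist P₁ W) Q ≤ η) →
        (0 < v / 2 ∧ v / 2 ≤ condDivVar W Q P) ∧
        (∀ Pstar : X → ℝ, isCAID W Pstar →
          (∀ P' : X → ℝ, isCAID W P' → dist2 P Pstar ≤ dist2 P P') →
          |Real.sqrt (infoVar P W) - Real.sqrt (infoVar Pstar W)| ≤ β * dist2 P Pstar) ∧
        |Real.sqrt (condDivVar W Q P) - Real.sqrt (infoVar P W)| ≤ β * dist2 Q (outDist P W) := by
  by_cases hex : ∃ P₀, isCAID W P₀
  swap
  · exact ⟨1, one_pos, 1, one_pos, 1, one_pos, fun P _ ⟨P₀, h₀, _⟩ => (hex ⟨P₀, h₀⟩).elim⟩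
  obtain ⟨P₀, hP₀⟩ := hex
  obtain ⟨y₀, hy₀⟩ := Finite.exists_min (outDist P₀ W)
  obtain ⟨δ, hδ⟩ : ∃ δ, δ = outDist P₀ W y₀ := ⟨_, rfl⟩
  have hδ0 : 0 < δ := by
    obtain ⟨x, hx⟩ := hacc y₀
    exact hδ ▸ hP₀.outDist_pos hW hx
  rw [← hδ] at hy₀
  obtain ⟨K, hK⟩ := exists_lipschitzOnWith_condDivVar W (half_pos hδ0)
  obtain ⟨N, hN⟩ : ∃ N : ℝ, N = Fintype.card X + 1 := ⟨_, rfl⟩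
  have hN1 : 1 ≤ N := by rw [hN]; linarith [(Fintype.card X).cast_nonneg (α := ℝ)]
  have hN0 : 0 < N := by linarith
  have hK0 : (0 : ℝ) ≤ K := K.2
  obtain ⟨ε, hε⟩ : ∃ ε, ε = min (δ / 4) (v / (6 * (K + 1))) := ⟨_, rfl⟩
  have hε0 : 0 < ε := hε ▸ lt_min (by positivity) (by positivity)
  have hεδ : ε ≤ δ / 4 := hε ▸ min_le_left _ _
  have hεv : K * (3 * ε) ≤ v / 2 := by
    have h1 : ε ≤ v / (6 * (K + 1)) := hε ▸ min_le_right _ _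
    rw [le_div_iff₀ (by positivity)] at h1
    nlinarith
  have hsv : 0 < Real.sqrt v := Real.sqrt_pos.2 hv
  have hout : ∀ P P' : X → ℝ, dist (outDist P W) (outDist P' W) ≤ N * dist P P' := fun P P' =>
    (dist_outDist_le hW P P').trans (mul_le_mul_of_nonneg_right (by linarith) dist_nonneg)
  have hnear : ∀ P : X → ℝ, (∃ P', isCAID W P' ∧ dist2 P P' ≤ ε / N) →
      dist (outDist P W) (outDist P₀ W) ≤ ε := by
    rintro P ⟨P', hP', hd⟩
    rw [hP₀.outDist_eq hW hP']
    refine (hout P P').trans ?_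
    rw [mul_comm, ← le_div_iff₀ hN0]
    exact (dist_le_dist2 P P').trans hd
  have hmem : ∀ P : X → ℝ, IsDist P → ∀ Q : Y → ℝ, IsDist Q →
      dist Q (outDist P₀ W) ≤ 2 * ε →
      (P, Q) ∈ (Set.Icc 0 1 ×ˢ Set.Icc (fun _ : Y => δ / 2) 1 : Set ((X → ℝ) × (Y → ℝ))) := by
    intro P hP Q hQ hd
    refine ⟨⟨hP.1, hP.le_one⟩, fun y => ?_, hQ.le_one⟩
    have h1 := (dist_le_pi_dist Q (outDist P₀ W) y).trans hd
    rw [Real.dist_eq, abs_le] at h1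
    linarith [hy₀ y]
  refine ⟨ε / N, by positivity, ε, hε0, (K * N + 1) / Real.sqrt v, by positivity, ?_⟩
  rintro P hP hPμ hPv Q hQ ⟨P₁, -, hP₁μ, hQη⟩
  have hPq := hnear P hPμ
  have hQq : dist Q (outDist P₀ W) ≤ 2 * ε := by
    have h1 := (dist_le_dist2 _ _).trans hQη
    rw [dist_comm] at h1
    linarith [dist_triangle Q (outDist P₁ W) (outDist P₀ W), hnear P₁ hP₁μ]
  have hPmem := hmem P hP _ (hP.outDist hW) (by linarith)
  have hQlip : |condDivVar W Q P - infoVar P W| ≤ K * dist Q (outDist P W) := by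
    simpa [Prod.dist_eq, Real.dist_eq] using! hK.dist_le_mul _ (hmem P hP Q hQ hQq) _ hPmem
  have hscale : ∀ a d e : ℝ, 0 ≤ d → a ≤ K * (N * d) → d ≤ e →
      a / Real.sqrt v ≤ (K * N + 1) / Real.sqrt v * e := by
    intro a d e hd ha hde
    rw [div_mul_eq_mul_div]
    refine div_le_div_of_nonneg_right ?_ hsv.le
    nlinarith [mul_le_mul_of_nonneg_left hde (mul_nonneg hK0 hN0.le)]
  refine ⟨⟨half_pos hv, ?_⟩, fun Pstar hPs _ => ?_, ?_⟩
  · have h1 : dist Q (outDist P W) ≤ 3 * ε := by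
      linarith [dist_triangle_right Q (outDist P W) (outDist P₀ W)]
    have h2 := (abs_le.1 (hQlip.trans (mul_le_mul_of_nonneg_left h1 hK0))).1
    linarith
  · have hs := hmem Pstar hPs.1 _ (hPs.1.outDist hW)
      (by rw [hP₀.outDist_eq hW hPs, dist_self]; positivity)
    have h1 : |infoVar Pstar W - infoVar P W| ≤ K * (N * dist P Pstar) := by
      have h2 := hK.dist_le_mul _ hs _ hPmem
      rw [Prod.dist_eq] at h2
      refine h2.trans (mul_le_mul_of_nonneg_left (max_le ?_ ?_) hK0)
      · rw [dist_comm]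
        exact le_mul_of_one_le_left dist_nonneg hN1
      · rw [dist_comm P]
        exact hout _ _
    rw [abs_sub_comm]
    exact (abs_sqrt_sub_sqrt_le hv hPv (condDivVar_nonneg hW _ hPs.1)).trans
      (hscale _ _ _ dist_nonneg h1 (dist_le_dist2 _ _))
  · exact (abs_sqrt_sub_sqrt_le hv hPv (condDivVar_nonneg hW _ hP)).trans
      (hscale _ _ _ dist_nonneg (hQlip.trans (mul_le_mul_of_nonneg_left
        (le_mul_of_one_le_left dist_nonneg hN1) hK0)) (dist_le_dist2 _ _))
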